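/- arXiv:1908.03644 — 3 statements merged into one kernel-verified Lean document; each statement's English description precedes it below -/
import Mathlib

section
/- Petrović's theorem on elliptic solutions (Acta Mathematica 1899): let f = Σ_{i=1}^{j} a_i·Π_{j'=0}^{n} (y^{(j')})^{m_{j'i}} define an explicit polynomial ODE f(y, y′, …, y^{(n)}) = 0 (not containing x), with a_i ∈ ℂ∖{0} and pairwise distinct exponent multi-indices. Suppose y is a nonconstant elliptic function satisfying f(y(x), y′(x), …, y^{(n)}(x)) = 0 for all x at which y is analytic. Let x₀ be a pole of y, of order k ≥ 1, with Laurent expansion y(x) = c₀(x−x₀)^{−k} + O((x−x₀)^{−k+1}), c₀ ≠ 0, and set λ = −k. Then Σ_{i ∈ I} A_i(λ)·c₀^{M_i}·a_i = 0, where I is the set of indices attaining min_i(λM_i − N_i). In particular, since A_i(λ) ≠ 0 for the negative integer λ, the set I contains at least two indices, so the polygon of the equation possesses Property I: it has either an edge with the negative integer angular coefficient λ or a multiple vertex whose characteristic equation has λ as a root. -/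
open scoped Topology Classical

/-- `M i = ∑ j', m j' i`, the total degree of the `i`-th monomial of an explicit
polynomial ODE `∑ i, a i · ∏ j', (y^{(j')}) ^ (m j' i) = 0`. -/
def Mdeg {n j : ℕ} (m : Fin (n + 1) → Fin j → ℕ) (i : Fin j) : ℕ :=
  ∑ j' : Fin (n + 1), m j' i

/-- `N i = ∑ j', j' · m j' i`, the weight of the `i`-th monomial. -/
def Ndeg {n j : ℕ} (m : Fin (n + 1) → Fin j → ℕ) (i : Fin j) : ℕ :=
  ∑ j' : Fin (n + 1), (j' : ℕ) * m j' i

/-- `A i (λ) = ∏ j', (λ (λ-1) ⋯ (λ - j' + 1)) ^ (m j' i)` (the factor for `j' = 0`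
being `1`). -/
noncomputable def Acoef {n j : ℕ} (m : Fin (n + 1) → Fin j → ℕ) (lam : ℂ)
    (i : Fin j) : ℂ :=
  ∏ j' : Fin (n + 1), (∏ r ∈ Finset.range (j' : ℕ), (lam - r)) ^ (m j' i)

/-- The set of indices attaining `min_i (λ M i - N i)`: the leading terms of the
equation for the exponent `λ`. -/
noncomputable def leadIdx {n j : ℕ} (m : Fin (n + 1) → Fin j → ℕ) (lam : ℝ) :
    Finset (Fin j) :=
  Finset.univ.filter fun i : Fin j =>
    ∀ i' : Fin j,
      lam * (Mdeg m i : ℝ) - (Ndeg m i : ℝ) ≤ lam * (Mdeg m i' : ℝ) - (Ndeg m i' : ℝ)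

/-- `f` is a nonzero-period doubly periodic function: it admits periods `ω₁, ω₂ ≠ 0`
with nonreal ratio. -/
def DoublyPeriodic (f : ℂ → ℂ) : Prop :=
  ∃ ω₁ ω₂ : ℂ, ω₁ ≠ 0 ∧ ω₂ ≠ 0 ∧ (ω₂ / ω₁).im ≠ 0 ∧
    ∀ x : ℂ, f (x + ω₁) = f x ∧ f (x + ω₂) = f x

theorem petrovic_aux_laurent (y : ℂ → ℂ) (x₀ : ℂ) (hy : MeromorphicAt y x₀) (k : ℕ) (c₀ : ℂ)
    (hc₀ : c₀ ≠ 0)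
    (hpole : (fun x => y x - c₀ * (x - x₀) ^ (-(k : ℤ))) =O[𝓝[≠] x₀]
      fun x => (x - x₀) ^ (-(k : ℤ) + 1)) :
    ∃ g : ℂ → ℂ, AnalyticAt ℂ g x₀ ∧ g x₀ = c₀ ∧
      ∀ᶠ x in 𝓝[≠] x₀, y x = (x - x₀) ^ (-(k : ℤ)) * g x := by
  have hne : ∀ᶠ x in 𝓝[≠] x₀, x - x₀ ≠ 0 := by
    filter_upwards [self_mem_nhdsWithin] with x hx
    exact sub_ne_zero.2 hx
  have hsub : Filter.Tendsto (fun x : ℂ => x - x₀) (𝓝[≠] x₀) (𝓝 0) := by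
    have : ContinuousAt (fun x : ℂ => x - x₀) x₀ := by fun_prop
    have h := this.tendsto
    simp only [sub_self] at h
    exact h.mono_left nhdsWithin_le_nhds
  have hF : MeromorphicAt (fun x => (x - x₀) ^ k * y x) x₀ := by fun_prop
  have hlim : Filter.Tendsto (fun x => (x - x₀) ^ k * y x) (𝓝[≠] x₀) (𝓝 c₀) := by
    have h1 := (Asymptotics.isBigO_refl (fun x : ℂ => (x - x₀) ^ k) (𝓝[≠] x₀)).mul hpole
    have h2 : (fun x => (x - x₀) ^ k * y x - c₀) =O[𝓝[≠] x₀] fun x => x - x₀ := by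
      refine h1.congr' ?_ ?_
      · filter_upwards [hne] with x hx
        have : (x - x₀) ^ k ≠ 0 := pow_ne_zero _ hx
        simp only [zpow_neg, zpow_natCast]
        field_simp
      · filter_upwards [hne] with x hx
        have : (x - x₀) ^ k ≠ 0 := pow_ne_zero _ hx
        rw [zpow_add₀ hx]
        simp only [zpow_neg, zpow_natCast, zpow_one]
        field_simp
    have h3 := h2.trans_tendsto hsub
    simpa using h3.add_const c₀
  have hord : meromorphicOrderAt (fun x => (x - x₀) ^ k * y x) x₀ = ((0 : ℤ) : WithTop ℤ) := by
    have := (tendsto_ne_zero_iff_meromorphicOrderAt_eq_zero hF).1 ⟨c₀, hc₀, hlim⟩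
    simpa using this
  obtain ⟨g, hg, -, hgeq⟩ := (meromorphicOrderAt_eq_int_iff hF).1 hord
  refine ⟨g, hg, ?_, ?_⟩
  · have h1 : Filter.Tendsto g (𝓝[≠] x₀) (𝓝 (g x₀)) :=
      hg.continuousAt.tendsto.mono_left nhdsWithin_le_nhds
    refine tendsto_nhds_unique h1 (hlim.congr' ?_)
    filter_upwards [hgeq] with x hx
    simpa using hx
  · filter_upwards [hgeq, hne] with x hx hx0
    have h0 : (x - x₀) ^ k ≠ 0 := pow_ne_zero _ hx0
    have : g x = (x - x₀) ^ k * y x := by simpa using hx.symm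
    rw [this, zpow_neg, zpow_natCast]
    field_simp

theorem petrovic_aux_deriv (y : ℂ → ℂ) (x₀ : ℂ) (k : ℕ) (g : ℂ → ℂ) (hg : AnalyticAt ℂ g x₀)
    (hy : ∀ᶠ x in 𝓝[≠] x₀, y x = (x - x₀) ^ (-(k : ℤ)) * g x) (l : ℕ) :
    ∃ h : ℂ → ℂ, AnalyticAt ℂ h x₀ ∧
      h x₀ = (∏ r ∈ Finset.range l, (-(k : ℂ) - r)) * g x₀ ∧
      ∀ᶠ x in 𝓝[≠] x₀, iteratedDeriv l y x = (x - x₀) ^ (-((k + l : ℕ) : ℤ)) * h x := by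
  induction l with
  | zero => exact ⟨g, hg, by simp, by simpa using hy⟩
  | succ l ih =>
    obtain ⟨h, ha, h0, he⟩ := ih
    refine ⟨fun x => (-(k : ℂ) - l) * h x + (x - x₀) * deriv h x, ?_, ?_, ?_⟩
    · have := ha.deriv
      fun_prop
    · simp only [sub_self, zero_mul, add_zero, h0, Finset.prod_range_succ]
      ring
    · have hev : ∀ᶠ x in 𝓝[≠] x₀, AnalyticAt ℂ h x :=
        ha.eventually_analyticAt.filter_mono nhdsWithin_le_nhds
      filter_upwards [eventually_eventually_nhdsWithin.2 he, hev, self_mem_nhdsWithin]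
        with x hx hax hne
      have hx0 : x - x₀ ≠ 0 := sub_ne_zero.2 hne
      have hx' : iteratedDeriv l y =ᶠ[𝓝 x]
          fun x => (x - x₀) ^ (-((k + l : ℕ) : ℤ)) * h x := by
        rw [IsOpen.nhdsWithin_eq isOpen_compl_singleton hne] at hx
        exact hx
      rw [iteratedDeriv_succ, hx'.deriv_eq]
      have d1 : HasDerivAt (fun x : ℂ => (x - x₀) ^ (-((k + l : ℕ) : ℤ)))
          (((-((k + l : ℕ) : ℤ) : ℤ) : ℂ) * (x - x₀) ^ (-((k + l : ℕ) : ℤ) - 1) * 1) x :=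
        HasDerivAt.comp (h₂ := fun z : ℂ => z ^ (-((k + l : ℕ) : ℤ))) (h := fun z : ℂ => z - x₀) x
          (hasDerivAt_zpow _ (x - x₀) (Or.inl hx0)) ((hasDerivAt_id x).sub_const x₀)
      have d2 := (d1.mul hax.differentiableAt.hasDerivAt).deriv
      refine Eq.trans d2 ?_
      have e1 : (-((k + (l + 1) : ℕ) : ℤ)) = -((k + l : ℕ) : ℤ) - 1 := by push_cast; ring
      rw [e1, zpow_sub_one₀ hx0]
      push_cast
      field_simp
      ring

theorem petrovic_aux_main (x₀ : ℂ)
    (n j : ℕ) (hj : 1 ≤ j)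
    (m : Fin (n + 1) → Fin j → ℕ)
    (a : Fin j → ℂ)
    (y : ℂ → ℂ) (hy : MeromorphicAt y x₀)
    (hode : ∀ x : ℂ, AnalyticAt ℂ y x →
      ∑ i : Fin j, a i *
        ∏ j' : Fin (n + 1), iteratedDeriv (j' : ℕ) y x ^ (m j' i) = 0)
    (k : ℕ) (c₀ : ℂ) (hc₀ : c₀ ≠ 0)
    (hpole : (fun x => y x - c₀ * (x - x₀) ^ (-(k : ℤ))) =O[𝓝[≠] x₀]
      fun x => (x - x₀) ^ (-(k : ℤ) + 1)) :
    (leadIdx m (-(k : ℝ))).Nonempty ∧ (∑ i ∈ leadIdx m (-(k : ℝ)),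
        Acoef m (-(k : ℂ)) i * c₀ ^ (Mdeg m i) * a i = 0) := by
  obtain ⟨g, hg, hg0, hge⟩ := petrovic_aux_laurent y x₀ hy k c₀ hc₀ hpole
  choose h hha hh0 hhe using petrovic_aux_deriv y x₀ k g hg hge
  haveI : Nonempty (Fin j) := ⟨⟨0, hj⟩⟩
  obtain ⟨i₀, -, hi₀⟩ := Finset.exists_max_image (Finset.univ : Finset (Fin j))
    (fun i => k * Mdeg m i + Ndeg m i) Finset.univ_nonempty
  have hmem : ∀ i, i ∈ leadIdx m (-(k : ℝ)) ↔
      k * Mdeg m i + Ndeg m i = k * Mdeg m i₀ + Ndeg m i₀ := by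
    intro i
    simp only [leadIdx, Finset.mem_filter, Finset.mem_univ, true_and]
    constructor
    · intro hi
      refine le_antisymm (hi₀ i (Finset.mem_univ _)) ?_
      have := hi i₀
      have h2 : (k : ℝ) * Mdeg m i₀ + Ndeg m i₀ ≤ k * Mdeg m i + Ndeg m i := by linarith
      exact_mod_cast h2
    · intro hi i'
      have h1 := hi₀ i' (Finset.mem_univ _)
      rw [← hi] at h1
      have h2 : (k : ℝ) * Mdeg m i' + Ndeg m i' ≤ k * Mdeg m i + Ndeg m i := by exact_mod_cast h1
      linarith
  refine ⟨⟨i₀, (hmem i₀).2 rfl⟩, ?_⟩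
  set μ := k * Mdeg m i₀ + Ndeg m i₀ with hμ
  let Φ : ℂ → ℂ := fun x => ∑ i : Fin j, a i * ((x - x₀) ^ (μ - (k * Mdeg m i + Ndeg m i)) *
    ∏ j' : Fin (n + 1), h j' x ^ (m j' i))
  have hΦc : ContinuousAt Φ x₀ := by
    have : ∀ l, ContinuousAt (h l) x₀ := fun l => (hha l).continuousAt
    fun_prop
  have han : ∀ᶠ x in 𝓝[≠] x₀, AnalyticAt ℂ y x := hy.eventually_analyticAt
  have hall : ∀ᶠ x in 𝓝[≠] x₀, ∀ j' : Fin (n + 1), iteratedDeriv (j' : ℕ) y x =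
      (x - x₀) ^ (-((k + (j' : ℕ) : ℕ) : ℤ)) * h j' x :=
    Filter.eventually_all.2 fun j' => hhe j'
  have hΦ0 : ∀ᶠ x in 𝓝[≠] x₀, Φ x = 0 := by
    filter_upwards [han, hall, self_mem_nhdsWithin] with x hx1 hx2 hne
    have hx0 : x - x₀ ≠ 0 := sub_ne_zero.2 hne
    have hz := hode x hx1
    have : Φ x = (x - x₀) ^ μ * ∑ i : Fin j, a i *
        ∏ j' : Fin (n + 1), iteratedDeriv (j' : ℕ) y x ^ (m j' i) := by
      simp only [Φ]
      rw [Finset.mul_sum]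
      refine Finset.sum_congr rfl fun i _ => ?_
      have e1 : ∏ j' : Fin (n + 1), iteratedDeriv (j' : ℕ) y x ^ (m j' i) =
          ((x - x₀) ^ (k * Mdeg m i + Ndeg m i))⁻¹ * ∏ j' : Fin (n + 1), h j' x ^ (m j' i) := by
        have e2 : k * Mdeg m i + Ndeg m i = ∑ j' : Fin (n + 1), (k + (j' : ℕ)) * m j' i := by
          simp only [Mdeg, Ndeg, Finset.mul_sum, add_mul, Finset.sum_add_distrib]
        rw [e2, ← Finset.prod_pow_eq_pow_sum, ← Finset.prod_inv_distrib, ← Finset.prod_mul_distrib]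
        refine Finset.prod_congr rfl fun j' _ => ?_
        rw [hx2 j', mul_pow, zpow_neg, zpow_natCast, inv_pow, ← pow_mul]
      rw [e1, pow_sub₀ _ hx0 (hi₀ i (Finset.mem_univ _))]
      ring
    rw [this, hz, mul_zero]
  have hval : Φ x₀ = 0 := by
    have h1 : Filter.Tendsto Φ (𝓝[≠] x₀) (𝓝 (Φ x₀)) :=
      hΦc.tendsto.mono_left nhdsWithin_le_nhds
    have h2 : Filter.Tendsto Φ (𝓝[≠] x₀) (𝓝 0) :=
      tendsto_const_nhds.congr' (hΦ0.mono fun x hx => hx.symm)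
    exact tendsto_nhds_unique h1 h2
  rw [← hval]
  have hsub : leadIdx m (-(k : ℝ)) ⊆ Finset.univ := Finset.subset_univ _
  simp only [Φ]
  rw [← Finset.sum_subset hsub]
  · refine Finset.sum_congr rfl fun i hi => ?_
    rw [(hmem i).1 hi]
    simp only [sub_self, Nat.sub_self, pow_zero, one_mul, Acoef, Mdeg, hh0, hg0, mul_pow,
      Finset.prod_mul_distrib, Finset.prod_pow_eq_pow_sum]
    ring
  · intro i _ hi
    have h1 : k * Mdeg m i + Ndeg m i ≤ μ := hi₀ i (Finset.mem_univ _)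
    have h2 : k * Mdeg m i + Ndeg m i ≠ μ := fun e => hi ((hmem i).2 e)
    have h3 : μ - (k * Mdeg m i + Ndeg m i) ≠ 0 := by omega
    rw [sub_self, zero_pow h3]
    ring

/-- **Petrović's theorem on elliptic solutions (Acta Mathematica, 1899).**  Let
`∑ i, a i · ∏ j', (y^{(j')}) ^ (m j' i) = 0` be an explicit polynomial ODE (not
containing `x`) with nonzero constant coefficients and pairwise distinct exponent
multi-indices, and let `y` be a nonconstant elliptic solution.  If `x₀` is a pole of
`y` of order `k ≥ 1` with leading Laurent coefficient `c₀ ≠ 0`, then for `λ = -k` the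
approximate equation `∑_{i ∈ I} A_i(λ) c₀^{M_i} a_i = 0` holds, `I` being the set of
indices attaining `min_i (λ M_i - N_i)`; moreover `I` contains at least two indices, so
the polygon of the equation possesses Property I. -/
theorem petrovic_elliptic_solutions
    (n j : ℕ) (hj : 1 ≤ j)
    (m : Fin (n + 1) → Fin j → ℕ)
    (hdistinct : ∀ i i' : Fin j, (∀ j', m j' i = m j' i') → i = i')
    (a : Fin j → ℂ) (ha : ∀ i, a i ≠ 0)
    (y : ℂ → ℂ) (hy : MeromorphicOn y Set.univ)
    (hper : DoublyPeriodic y)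
    (hnonconst : ¬ ∃ cst : ℂ, ∀ x : ℂ, AnalyticAt ℂ y x → y x = cst)
    (hode : ∀ x : ℂ, AnalyticAt ℂ y x →
      ∑ i : Fin j, a i *
        ∏ j' : Fin (n + 1), iteratedDeriv (j' : ℕ) y x ^ (m j' i) = 0)
    (x₀ : ℂ) (k : ℕ) (hk : 1 ≤ k) (c₀ : ℂ) (hc₀ : c₀ ≠ 0)
    (hpole : (fun x => y x - c₀ * (x - x₀) ^ (-(k : ℤ))) =O[𝓝[≠] x₀]
      fun x => (x - x₀) ^ (-(k : ℤ) + 1)) :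
    (∑ i ∈ leadIdx m (-(k : ℝ)),
        Acoef m (-(k : ℂ)) i * c₀ ^ (Mdeg m i) * a i = 0) ∧
    ∃ i ∈ leadIdx m (-(k : ℝ)), ∃ i' ∈ leadIdx m (-(k : ℝ)), i ≠ i' := by
  obtain ⟨⟨i, hi⟩, hsum⟩ := petrovic_aux_main x₀ n j hj m a y (hy x₀ (Set.mem_univ _)) hode k c₀
    hc₀ hpole
  refine ⟨hsum, i, hi, ?_⟩
  by_contra hcon
  push Not at hcon
  have hs : leadIdx m (-(k : ℝ)) = {i} := by
    ext i'
    simp only [Finset.mem_singleton]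
    exact ⟨fun h' => (hcon i' h').symm, fun h' => h' ▸ hi⟩
  rw [hs, Finset.sum_singleton] at hsum
  have hA : Acoef m (-(k : ℂ)) i ≠ 0 := by
    unfold Acoef
    refine Finset.prod_ne_zero_iff.2 fun j' _ => pow_ne_zero _ ?_
    refine Finset.prod_ne_zero_iff.2 fun r _ => ?_
    have h1 : ((k + r : ℕ) : ℂ) ≠ 0 := Nat.cast_ne_zero.2 (by omega)
    intro h2
    apply h1
    push_cast
    linear_combination -h2
  exact mul_ne_zero (mul_ne_zero hA (pow_ne_zero _ hc₀)) (ha i) hsum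
end

section
/- Let P, Q ∈ ℂ[X] be polynomials with deg P = m ≥ 1 and deg Q = n ≥ 1. If there exists a nonconstant elliptic function y satisfying P(y″(x)) = Q(y(x)) for all x at which y is analytic, then n > m and (n − m) divides 2m; moreover every pole of y has order k = 2m/(n − m). -/
open scoped Topology Classical

open Filter Polynomial in
lemma petrovic_order_eval (P : Polynomial ℂ) (hP : 1 ≤ P.natDegree) (f : ℂ → ℂ) (x : ℂ)
    (hf : MeromorphicAt f x) (k : ℕ) (hk : 1 ≤ k)
    (ho : meromorphicOrderAt f x = ((-(k : ℤ) : ℤ) : WithTop ℤ)) :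
    MeromorphicAt (fun z => P.eval (f z)) x ∧
    meromorphicOrderAt (fun z => P.eval (f z)) x
      = ((-((P.natDegree * k : ℕ) : ℤ) : ℤ) : WithTop ℤ) := by
  have hdeg : 0 < P.degree := Polynomial.natDegree_pos_iff_degree_pos.1 hP
  clear hP
  refine Polynomial.degree_pos_induction_on (P := fun P : Polynomial ℂ =>
    MeromorphicAt (fun z => P.eval (f z)) x ∧
    meromorphicOrderAt (fun z => P.eval (f z)) x
      = ((-((P.natDegree * k : ℕ) : ℤ) : ℤ) : WithTop ℤ)) P hdeg ?_ ?_ ?_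
  · intro a ha
    have hc : MeromorphicAt (fun _ : ℂ => a) x := MeromorphicAt.const a x
    have e : (fun z => (C a * X : Polynomial ℂ).eval (f z)) = (fun _ : ℂ => a) * f := by
      ext z; simp
    rw [e]
    refine ⟨hc.mul hf, ?_⟩
    rw [meromorphicOrderAt_mul hc hf, meromorphicOrderAt_const, if_neg ha, ho,
      natDegree_C_mul_X a ha]
    simp
  · rintro p hp ⟨h1, h2⟩
    have e : (fun z => (p * X : Polynomial ℂ).eval (f z)) = (fun z => p.eval (f z)) * f := by
      ext z; simp
    have hp0 : p ≠ 0 := by rintro rfl; simp at hp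
    rw [e]
    refine ⟨h1.mul hf, ?_⟩
    rw [meromorphicOrderAt_mul h1 hf, h2, ho, natDegree_mul_X hp0, ← WithTop.coe_add]
    congr 1
    push_cast
    ring
  · rintro p a hp ⟨h1, h2⟩
    have hc : MeromorphicAt (fun _ : ℂ => a) x := MeromorphicAt.const a x
    have e : (fun z => (p + C a : Polynomial ℂ).eval (f z))
        = (fun z => p.eval (f z)) + (fun _ : ℂ => a) := by
      ext z; simp
    have hpn : 1 ≤ p.natDegree := Polynomial.natDegree_pos_iff_degree_pos.2 hp
    rw [e]
    refine ⟨h1.add hc, ?_⟩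
    rw [meromorphicOrderAt_add_eq_left_of_lt hc, h2, natDegree_add_C]
    rw [h2, meromorphicOrderAt_const]
    split_ifs
    · exact WithTop.coe_lt_top _
    · have : 0 < p.natDegree * k := Nat.mul_pos hpn hk
      have h3 : (-((p.natDegree * k : ℕ) : ℤ)) < 0 := by omega
      exact_mod_cast h3

lemma petrovic_arith (P Q : Polynomial ℂ) (hm : 1 ≤ P.natDegree) (hn : 1 ≤ Q.natDegree)
    (y : ℂ → ℂ) (hy : MeromorphicOn y Set.univ)
    (hode : ∀ x : ℂ, AnalyticAt ℂ y x → P.eval (iteratedDeriv 2 y x) = Q.eval (y x))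
    (x : ℂ) (k : ℕ) (hk : 1 ≤ k)
    (ho : meromorphicOrderAt y x = ((-(k : ℤ) : ℤ) : WithTop ℤ)) :
    P.natDegree * (k + 2) = Q.natDegree * k := by
  have hyx : MeromorphicAt y x := hy x (Set.mem_univ _)
  have h1 : meromorphicOrderAt (deriv y) x = ((-(k : ℤ) - 1 : ℤ) : WithTop ℤ) :=
    meromorphicOrderAt_deriv_eq_sub_one (by exact_mod_cast (by omega : (-(k : ℤ)) ≠ 0)) ho
  have h2 : meromorphicOrderAt (deriv (deriv y)) x = ((-(k : ℤ) - 1 - 1 : ℤ) : WithTop ℤ) :=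
    meromorphicOrderAt_deriv_eq_sub_one (by exact_mod_cast (by omega : (-(k : ℤ) - 1) ≠ 0)) h1
  have h3 : (-(k : ℤ) - 1 - 1 : ℤ) = -((k + 2 : ℕ) : ℤ) := by push_cast; ring
  rw [h3] at h2
  have hP := (petrovic_order_eval P hm (deriv (deriv y)) x hyx.deriv.deriv (k + 2) (by omega) h2).2
  have hQ := (petrovic_order_eval Q hn y x hyx k hk ho).2
  have hev : (fun z => P.eval (deriv (deriv y) z)) =ᶠ[𝓝[≠] x] (fun z => Q.eval (y z)) := by
    filter_upwards [hyx.eventually_analyticAt] with z hz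
    have := hode z hz
    rwa [iteratedDeriv_succ, iteratedDeriv_one] at this
  have h4 := meromorphicOrderAt_congr hev
  rw [hP, hQ] at h4
  have h5 := WithTop.coe_injective h4
  exact_mod_cast neg_injective h5

lemma petrovic_order_of_expansion (y : ℂ → ℂ) (x₀ : ℂ) (hy : MeromorphicAt y x₀) (k : ℕ) (c₀ : ℂ)
    (hc : c₀ ≠ 0)
    (h : (fun x => y x - c₀ * (x - x₀) ^ (-(k : ℤ))) =O[𝓝[≠] x₀]
          fun x => (x - x₀) ^ (-(k : ℤ) + 1)) :
    meromorphicOrderAt y x₀ = ((-(k : ℤ) : ℤ) : WithTop ℤ) := by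
  have hne : ∀ᶠ x in 𝓝[≠] x₀, x - x₀ ≠ 0 := by
    filter_upwards [self_mem_nhdsWithin] with x hx
    exact sub_ne_zero.2 hx
  have ht0 : Filter.Tendsto (fun x : ℂ => x - x₀) (𝓝[≠] x₀) (𝓝 0) := by
    have : ContinuousAt (fun x : ℂ => x - x₀) x₀ := by fun_prop
    simpa using this.tendsto.mono_left nhdsWithin_le_nhds
  have hmul := (Asymptotics.isBigO_refl (fun x : ℂ => (x - x₀) ^ (k : ℤ)) (𝓝[≠] x₀)).mul h
  have hlim : Filter.Tendsto (fun x => (x - x₀) ^ (k : ℤ) * (y x - c₀ * (x - x₀) ^ (-(k : ℤ))))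
      (𝓝[≠] x₀) (𝓝 0) := by
    refine hmul.trans_tendsto (ht0.congr' ?_)
    filter_upwards [hne] with x hx
    rw [← zpow_add₀ hx]
    simp
  have hlim2 : Filter.Tendsto (fun x => (x - x₀) ^ (k : ℤ) * y x) (𝓝[≠] x₀) (𝓝 c₀) := by
    have := hlim.add_const c₀
    rw [zero_add] at this
    refine this.congr' ?_
    filter_upwards [hne] with x hx
    have : (x - x₀) ^ (k : ℤ) * (x - x₀) ^ (-(k : ℤ)) = 1 := by
      rw [← zpow_add₀ hx]; simp
    linear_combination (-c₀) * this
  have hz : MeromorphicAt (fun x : ℂ => (x - x₀) ^ (k : ℤ)) x₀ := by fun_prop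
  have h0 := (tendsto_ne_zero_iff_meromorphicOrderAt_eq_zero (hz.mul hy)).1 ⟨c₀, hc, hlim2⟩
  rw [meromorphicOrderAt_mul hz hy, fun_meromorphicOrderAt_zpow_id_sub_const] at h0
  cases hoy : meromorphicOrderAt y x₀ with
  | top => rw [hoy] at h0; simp at h0
  | coe a =>
    rw [hoy, ← WithTop.coe_add] at h0
    have h1 : (k : ℤ) + a = 0 := by exact_mod_cast h0
    congr 1
    omega

lemma petrovic_exists_pole (y : ℂ → ℂ) (hy : MeromorphicOn y Set.univ)
    (hper : DoublyPeriodic y)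
    (hnonconst : ¬ ∃ cst : ℂ, ∀ x : ℂ, AnalyticAt ℂ y x → y x = cst) :
    ∃ x, meromorphicOrderAt y x < 0 := by
  by_contra! hcon
  apply hnonconst
  set g := toMeromorphicNFOn y Set.univ with hg
  have hga : ∀ x, AnalyticAt ℂ g x := fun x => by
    have hnf : MeromorphicNFAt g x := meromorphicNFOn_toMeromorphicNFOn y Set.univ (Set.mem_univ x)
    rw [← hnf.meromorphicOrderAt_nonneg_iff_analyticAt, hg,
      meromorphicOrderAt_toMeromorphicNFOn hy (Set.mem_univ x)]
    exact hcon x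
  have hgy : ∀ x, g =ᶠ[𝓝[≠] x] y := fun x =>
    hy.toMeromorphicNFOn_eq_self_on_nhdsNE (Set.mem_univ x)
  have hgc : ∀ x, ContinuousAt g x := fun x => (hga x).continuousAt
  have hgper : ∀ ω : ℂ, (∀ x, y (x + ω) = y x) → ∀ x, g (x + ω) = g x := by
    intro ω hω x
    have hc : ContinuousAt (fun z => g (z + ω)) x :=
      ContinuousAt.comp (f := fun z => z + ω) (g := g) (hgc (x + ω)) (by fun_prop)
    have hmap : Filter.Tendsto (fun z : ℂ => z + ω) (𝓝[≠] x) (𝓝[≠] (x + ω)) := by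
      refine tendsto_nhdsWithin_iff.2 ⟨?_, ?_⟩
      · have : ContinuousAt (fun z : ℂ => z + ω) x := by fun_prop
        exact this.tendsto.mono_left nhdsWithin_le_nhds
      · filter_upwards [self_mem_nhdsWithin] with z hz
        simpa using hz
    refine tendsto_nhds_unique (hc.tendsto.mono_left (nhdsWithin_le_nhds (s := {x}ᶜ)))
      (((hgc x).tendsto.mono_left nhdsWithin_le_nhds).congr' ?_)
    filter_upwards [hgy x, hmap.eventually (hgy (x + ω))] with z h1 h2
    rw [h1, h2, hω]
  obtain ⟨ω₁, ω₂, h1, h2, him, hp⟩ := hper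
  have hp1 : Function.Periodic g ω₁ := hgper ω₁ fun x => (hp x).1
  have hp2 : Function.Periodic g ω₂ := hgper ω₂ fun x => (hp x).2
  have hcont : Continuous g := continuous_iff_continuousAt.2 hgc
  have hcpt : IsCompact ((fun p : ℝ × ℝ => g (p.1 * ω₁ + p.2 * ω₂)) ''
      (Set.Icc 0 1 ×ˢ Set.Icc 0 1)) :=
    (isCompact_Icc.prod isCompact_Icc).image (by fun_prop)
  have hbdd : Bornology.IsBounded (Set.range g) := by
    refine hcpt.isBounded.subset ?_
    rintro _ ⟨z, rfl⟩
    set τ := ω₂ / ω₁ with hτ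
    set b : ℝ := (z / ω₁).im / τ.im with hb
    set a : ℝ := (z / ω₁).re - b * τ.re with ha
    have hz : z = a * ω₁ + b * ω₂ := by
      have h3 : z / ω₁ = a + b * τ := by
        apply Complex.ext
        · simp [ha]
        · simp [hb, him]
      have h4 : z = (z / ω₁) * ω₁ := by field_simp
      have h5 : ω₂ = τ * ω₁ := by rw [hτ]; field_simp
      rw [h4, h3, h5]; ring
    refine ⟨(Int.fract a, Int.fract b), ⟨⟨Int.fract_nonneg _, (Int.fract_lt_one _).le⟩,
      ⟨Int.fract_nonneg _, (Int.fract_lt_one _).le⟩⟩, ?_⟩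
    have h6 : z = ((Int.fract a : ℝ) * ω₁ + (Int.fract b : ℝ) * ω₂ + (⌊a⌋ : ℤ) * ω₁)
        + (⌊b⌋ : ℤ) * ω₂ := by
      have ea : (a : ℂ) = (⌊a⌋ : ℂ) + (Int.fract a : ℝ) := by
        exact_mod_cast (Int.floor_add_fract a).symm
      have eb : (b : ℂ) = (⌊b⌋ : ℂ) + (Int.fract b : ℝ) := by
        exact_mod_cast (Int.floor_add_fract b).symm
      linear_combination hz + ω₁ * ea + ω₂ * eb
    conv_rhs => rw [h6]
    rw [hp2.int_mul, hp1.int_mul]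
  have hdiff : Differentiable ℂ g := fun x => (hga x).differentiableAt
  refine ⟨g 0, fun x hx => ?_⟩
  rw [hdiff.apply_eq_apply_of_bounded hbdd 0 x]
  exact tendsto_nhds_unique
    (hx.continuousAt.tendsto.mono_left (nhdsWithin_le_nhds (s := {x}ᶜ)))
    (((hgc x).tendsto.mono_left nhdsWithin_le_nhds).congr' (hgy x))

/-- **Petrović's necessary condition for elliptic solutions of `P(y'') = Q(y)`
(Acta Mathematica, 1899).**  If `P, Q ∈ ℂ[X]` have degrees `m ≥ 1` and `n ≥ 1` and
there is a nonconstant elliptic function `y` with `P(y''(x)) = Q(y(x))` at every point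
of analyticity, then `n > m`, `(n - m) ∣ 2m`, and every pole of `y` has order
`k = 2m / (n - m)`. -/
theorem petrovic_Pm_ypp_eq_Qn_y
    (P Q : Polynomial ℂ) (m n : ℕ)
    (hdegP : P.natDegree = m) (hdegQ : Q.natDegree = n)
    (hm : 1 ≤ m) (hn : 1 ≤ n)
    (y : ℂ → ℂ) (hy : MeromorphicOn y Set.univ)
    (hper : DoublyPeriodic y)
    (hnonconst : ¬ ∃ cst : ℂ, ∀ x : ℂ, AnalyticAt ℂ y x → y x = cst)
    (hode : ∀ x : ℂ, AnalyticAt ℂ y x →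
      P.eval (iteratedDeriv 2 y x) = Q.eval (y x)) :
    m < n ∧ (n - m) ∣ 2 * m ∧
      ∀ (x₀ : ℂ) (k : ℕ) (c₀ : ℂ), 1 ≤ k → c₀ ≠ 0 →
        ((fun x => y x - c₀ * (x - x₀) ^ (-(k : ℤ))) =O[𝓝[≠] x₀]
          fun x => (x - x₀) ^ (-(k : ℤ) + 1)) →
        k * (n - m) = 2 * m := by
  subst hdegP hdegQ
  obtain ⟨x, hx⟩ := petrovic_exists_pole y hy hper hnonconst
  obtain ⟨k, hk, hko⟩ : ∃ k : ℕ, 1 ≤ k ∧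
      meromorphicOrderAt y x = ((-(k : ℤ) : ℤ) : WithTop ℤ) := by
    cases ho : meromorphicOrderAt y x with
    | top => rw [ho] at hx; simp at hx
    | coe a =>
      rw [ho] at hx
      have ha : a < 0 := by exact_mod_cast hx
      refine ⟨a.natAbs, by omega, ?_⟩
      congr 1
      omega
  have hA := petrovic_arith P Q hm hn y hy hode x k hk hko
  have hlt : P.natDegree < Q.natDegree := by nlinarith
  have key : ∀ k : ℕ, P.natDegree * (k + 2) = Q.natDegree * k →
      k * (Q.natDegree - P.natDegree) = 2 * P.natDegree := by
    intro k hA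
    obtain ⟨d, hd⟩ := Nat.exists_eq_add_of_lt hlt
    rw [hd] at hA ⊢
    have : P.natDegree + d + 1 - P.natDegree = d + 1 := by omega
    rw [this]
    nlinarith
  refine ⟨hlt, ⟨k, by rw [← key k hA, mul_comm]⟩, ?_⟩
  intro x₀ k' c₀ hk' hc₀ hO
  exact key k' (petrovic_arith P Q hm hn y hy hode x₀ k' hk'
    (petrovic_order_of_expansion y x₀ (hy x₀ (Set.mem_univ _)) k' c₀ hc₀ hO))
end

section
/- Petrović's partial first integral theorem (Acta Mathematica 1899): let Ψ = Σ_{i=1}^{j} b_i·Π_{j'=0}^{q} (z^{(j')})^{μ_{j'i}} define an explicit polynomial ODE Ψ(z, z′, …, z^{(q)}) = 0 with b_i ∈ ℂ∖{0} and pairwise distinct exponent multi-indices, and let M_i, N_i, A_i(λ) be defined from the multi-indices (μ_{0i},…,μ_{qi}). Suppose the polygon of Ψ does not possess Property I, in the strong sense that for every negative integer λ and every c ∈ ℂ∖{0} one has Σ_{i ∈ I_λ} A_i(λ)·c^{M_i}·b_i ≠ 0, where I_λ is the set of indices attaining min_i(λM_i − N_i). Then every function z, meromorphic on all of ℂ and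 doubly periodic with periods ω₁, ω₂ satisfying ω₂/ω₁ ∉ ℝ, which satisfies Ψ(z(x), z′(x), …, z^{(q)}(x)) = 0 for all x at which z is analytic, is constant. In particular, if z = R(y, y′, …, y^{(q)}) is a meromorphic function of this form built by a rational function R from a double-periodic solution y of another polynomial ODE, then R(y, y′, …, y^{(q)}) = const along that solution, i.e. R = const is a partial first integral along the double-periodic solutions. -/
open scoped Topology Classical

lemma deriv_pole (z : ℂ → ℂ) (x0 : ℂ) (lam : ℤ) (g : ℂ → ℂ) (hg : AnalyticAt ℂ g x0)
    (hz : ∀ᶠ x in 𝓝[≠] x0, z x = (x - x0) ^ lam * g x) (n : ℕ) :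
    ∃ h : ℂ → ℂ, AnalyticAt ℂ h x0 ∧ h x0 = (∏ r ∈ Finset.range n, ((lam : ℂ) - r)) * g x0 ∧
      ∀ᶠ x in 𝓝[≠] x0, iteratedDeriv n z x = (x - x0) ^ (lam - n) * h x := by
  induction n with
  | zero => exact ⟨g, hg, by simp, by simpa using hz⟩
  | succ n ih =>
    obtain ⟨h, ha, h0, he⟩ := ih
    refine ⟨fun x => ((lam : ℂ) - n) * h x + (x - x0) * deriv h x, ?_, ?_, ?_⟩
    · have := ha.deriv
      fun_prop
    · simp [h0, Finset.prod_range_succ]; ring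
    · have h1 : ∀ᶠ x in 𝓝[≠] x0, ∀ᶠ y in 𝓝 x, iteratedDeriv n z y = (y - x0) ^ (lam - n) * h y := by
        have := eventually_eventually_nhdsWithin.2 he
        filter_upwards [this, self_mem_nhdsWithin] with x hx hxm
        rwa [isOpen_compl_singleton.nhdsWithin_eq hxm] at hx
      have h2 : ∀ᶠ x in 𝓝[≠] x0, AnalyticAt ℂ h x :=
        ha.eventually_analyticAt.filter_mono nhdsWithin_le_nhds
      filter_upwards [h1, h2, self_mem_nhdsWithin] with x hx hax hxm
      have hne : x - x0 ≠ 0 := sub_ne_zero.2 hxm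
      rw [iteratedDeriv_succ, Filter.EventuallyEq.deriv_eq hx]
      have d1 : HasDerivAt (fun y => (y - x0) ^ (lam - n))
          (((lam - n : ℤ) : ℂ) * (x - x0) ^ (lam - n - 1)) x := by
        have := (hasDerivAt_zpow (lam - n) (x - x0) (Or.inl hne)).comp x
          ((hasDerivAt_id x).sub_const x0)
        simpa [Function.comp_def] using this
      refine (d1.mul hax.differentiableAt.hasDerivAt).deriv.trans ?_
      have e : lam - n = (lam - (n + 1 : ℕ)) + 1 := by push_cast; ring
      have e2 : lam - n - 1 = (lam - (n + 1 : ℕ)) := by push_cast; ring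
      rw [e2]
      conv_lhs => rw [e, zpow_add_one₀ hne]
      push_cast
      ring

lemma no_pole (q j : ℕ) (hj : 1 ≤ j) (μ : Fin (q + 1) → Fin j → ℕ) (b : Fin j → ℂ)
    (lam : ℤ) (z : ℂ → ℂ) (x0 : ℂ) (g : ℂ → ℂ) (hg : AnalyticAt ℂ g x0)
    (hz : ∀ᶠ x in 𝓝[≠] x0, z x = (x - x0) ^ lam * g x)
    (hode : ∀ᶠ x in 𝓝[≠] x0, ∑ i : Fin j, b i *
          ∏ j' : Fin (q + 1), iteratedDeriv (j' : ℕ) z x ^ (μ j' i) = 0) :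
    ∑ i ∈ leadIdx μ (lam : ℝ), Acoef μ (lam : ℂ) i * (g x0) ^ (Mdeg μ i) * b i = 0 := by
  choose h ha h0 he using deriv_pole z x0 lam g hg hz
  let e : Fin j → ℤ := fun i => lam * Mdeg μ i - Ndeg μ i
  have : Nonempty (Fin j) := ⟨⟨0, hj⟩⟩
  obtain ⟨i0, hi0⟩ := Finite.exists_min e
  let d : Fin j → ℕ := fun i => (e i - e i0).toNat
  have hd : ∀ i, (d i : ℤ) = e i - e i0 := fun i => Int.toNat_of_nonneg (by linarith [hi0 i])
  let F : ℂ → ℂ := fun x => ∑ i : Fin j, b i * ((x - x0) ^ d i *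
    ∏ j' : Fin (q + 1), h j' x ^ (μ j' i))
  have hFc : ContinuousAt F x0 := by
    have := fun n => (ha n).continuousAt
    fun_prop
  have hF0 : ∀ᶠ x in 𝓝[≠] x0, F x = 0 := by
    have hall : ∀ᶠ x in 𝓝[≠] x0, ∀ j' : Fin (q + 1),
        iteratedDeriv (j' : ℕ) z x = (x - x0) ^ (lam - (j' : ℕ)) * h j' x :=
      Filter.eventually_all.2 fun j' => he j'
    filter_upwards [hall, hode, self_mem_nhdsWithin] with x hx hox hxm
    have hne : x - x0 ≠ 0 := sub_ne_zero.2 hxm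
    have key : ∀ i, ∏ j' : Fin (q + 1), iteratedDeriv (j' : ℕ) z x ^ (μ j' i) =
        (x - x0) ^ e i0 * ((x - x0) ^ d i * ∏ j' : Fin (q + 1), h j' x ^ (μ j' i)) := by
      intro i
      rw [← mul_assoc, ← zpow_natCast (x - x0) (d i), ← zpow_add₀ hne, hd]
      simp only [hx, mul_pow, Finset.prod_mul_distrib]
      congr 1
      simp only [← zpow_natCast, ← zpow_mul]
      have hs : ∀ (s : Finset (Fin (q+1))) (f : Fin (q+1) → ℤ),
          ∏ k ∈ s, (x - x0) ^ f k = (x - x0) ^ (∑ k ∈ s, f k) := by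
        intro s f
        induction s using Finset.induction_on with
        | empty => simp
        | insert a s has ih => rw [Finset.prod_insert has, Finset.sum_insert has, ih, zpow_add₀ hne]
      rw [hs]
      congr 1
      simp only [e, Mdeg, Ndeg, sub_mul, Finset.sum_sub_distrib, ← Finset.mul_sum]
      push_cast
      ring
    have : (x - x0) ^ e i0 * F x = 0 := by
      rw [← hox, Finset.mul_sum]
      refine Finset.sum_congr rfl fun i _ => ?_
      rw [key]; ring
    exact (mul_eq_zero.1 this).resolve_left (zpow_ne_zero _ hne)
  have hFx : F x0 = 0 := by
    have t1 : Filter.Tendsto F (𝓝[≠] x0) (𝓝 (F x0)) := hFc.tendsto.mono_left nhdsWithin_le_nhds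
    have t2 : Filter.Tendsto F (𝓝[≠] x0) (𝓝 0) :=
      (Filter.tendsto_congr' hF0).2 tendsto_const_nhds
    exact tendsto_nhds_unique t1 t2
  rw [← hFx, leadIdx, Finset.sum_filter]
  refine Finset.sum_congr rfl fun i _ => ?_
  have hiff : (∀ i' : Fin j, (lam : ℝ) * (Mdeg μ i : ℝ) - (Ndeg μ i : ℝ) ≤
      lam * (Mdeg μ i' : ℝ) - (Ndeg μ i' : ℝ)) ↔ d i = 0 := by
    have : ∀ i', ((lam : ℝ) * (Mdeg μ i : ℝ) - (Ndeg μ i : ℝ) ≤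
      lam * (Mdeg μ i' : ℝ) - (Ndeg μ i' : ℝ)) ↔ e i ≤ e i' := by
      intro i'
      simp only [e]
      exact_mod_cast Iff.rfl
    simp only [this]
    have := hd i
    constructor
    · intro H; have := H i0; omega
    · intro H i'; have := hi0 i'; omega
  by_cases hc : d i = 0
  · rw [if_pos (hiff.2 hc), hc, pow_zero, one_mul]
    simp only [h0, mul_pow, Finset.prod_mul_distrib, Acoef, Mdeg, Finset.prod_pow_eq_pow_sum]
    ring
  · rw [if_neg (fun H => hc (hiff.1 H))]
    simp [hc]

lemma entire_periodic (f : ℂ → ℂ) (hf : Differentiable ℂ f) (hp : DoublyPeriodic f) :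
    ∃ c, ∀ x, f x = c := by
  obtain ⟨w1, w2, h1, h2, him, hper⟩ := hp
  have p1 : Function.Periodic f w1 := fun x => (hper x).1
  have p2 : Function.Periodic f w2 := fun x => (hper x).2
  have hK : IsCompact ((fun p : ℝ × ℝ => (p.1 : ℂ) * w1 + (p.2 : ℂ) * w2) ''
      (Set.Icc 0 1 ×ˢ Set.Icc 0 1)) :=
    (isCompact_Icc.prod isCompact_Icc).image (by fun_prop)
  have hb : Bornology.IsBounded (Set.range f) := by
    refine (hK.image hf.continuous).isBounded.subset ?_
    rintro _ ⟨x, rfl⟩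
    obtain ⟨s, t, hst⟩ : ∃ s t : ℝ, x = s * w1 + t * w2 := by
      let t := (x / w1).im / (w2 / w1).im
      let s := (x / w1).re - t * (w2 / w1).re
      refine ⟨s, t, ?_⟩
      have : x / w1 = s + t * (w2 / w1) := by
        apply Complex.ext
        · simp [s]
        · simp only [Complex.add_im, Complex.ofReal_im, 
            Complex.im_ofReal_mul, zero_add, t]
          field_simp
      field_simp at this
      rw [this]; ring
    refine ⟨_, ⟨(Int.fract s, Int.fract t), ⟨⟨Int.fract_nonneg _, (Int.fract_lt_one _).le⟩,
      ⟨Int.fract_nonneg _, (Int.fract_lt_one _).le⟩⟩, rfl⟩, ?_⟩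
    have e : ((Int.fract s : ℝ) : ℂ) * w1 + ((Int.fract t : ℝ) : ℂ) * w2
        = x - ⌊s⌋ • w1 - ⌊t⌋ • w2 := by
      rw [hst, Int.fract, Int.fract, zsmul_eq_mul, zsmul_eq_mul]; push_cast; ring
    simp only [e]
    rw [p2.sub_zsmul_eq, p1.sub_zsmul_eq]
  exact ⟨f 0, fun x => hf.apply_eq_apply_of_bounded hb x 0⟩

/-- **Petrović's partial first integral theorem (Acta Mathematica, 1899),
contrapositive form.**  Let `Ψ = ∑ i, b i · ∏ j', (z^{(j')}) ^ (μ j' i)` define an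
explicit polynomial ODE with nonzero constant coefficients and pairwise distinct
exponent multi-indices.  Suppose the polygon of `Ψ` does not possess Property I, in the
strong sense that for every negative integer `λ` and every `c ≠ 0` one has
`∑_{i ∈ I_λ} A_i(λ) c^{M_i} b_i ≠ 0`, where `I_λ` is the set of indices attaining
`min_i (λ M_i - N_i)`.  Then every doubly periodic function meromorphic on all of `ℂ`
that satisfies `Ψ(z, z', …, z^{(q)}) = 0` at every point of analyticity is constant;
in particular `R(y, y', …, y^{(q)}) = const` is a partial first integral along the
double-periodic solutions of the original equation. -/
theorem petrovic_partial_first_integral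
    (q j : ℕ) (hj : 1 ≤ j)
    (μ : Fin (q + 1) → Fin j → ℕ)
    (hdistinct : ∀ i i' : Fin j, (∀ j', μ j' i = μ j' i') → i = i')
    (b : Fin j → ℂ) (hb : ∀ i, b i ≠ 0)
    (hnoPropertyI : ∀ lam : ℤ, lam < 0 → ∀ c : ℂ, c ≠ 0 →
      ∑ i ∈ leadIdx μ (lam : ℝ), Acoef μ (lam : ℂ) i * c ^ (Mdeg μ i) * b i ≠ 0) :
    ∀ z : ℂ → ℂ, MeromorphicOn z Set.univ → DoublyPeriodic z →
      (∀ x : ℂ, AnalyticAt ℂ z x →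
        ∑ i : Fin j, b i *
          ∏ j' : Fin (q + 1), iteratedDeriv (j' : ℕ) z x ^ (μ j' i) = 0) →
      ∃ cst : ℂ, ∀ x : ℂ, AnalyticAt ℂ z x → z x = cst := by
  intro z hm hp hode
  have hord : ∀ x, 0 ≤ meromorphicOrderAt z x := by
    intro x0
    by_contra hlt
    push Not at hlt
    obtain ⟨lam, hlam⟩ := WithTop.ne_top_iff_exists.1 hlt.ne_top
    rw [← hlam] at hlt
    obtain ⟨g, hg, hg0, hz⟩ := (meromorphicOrderAt_eq_int_iff (hm x0 trivial)).1 hlam.symm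
    refine hnoPropertyI lam (by exact_mod_cast hlt) (g x0) hg0
      (no_pole q j hj μ b lam z x0 g hg hz ?_)
    filter_upwards [(hm x0 trivial).eventually_analyticAt] with x hx using hode x hx
  let f := toMeromorphicNFOn z Set.univ
  have hfz : ∀ x, z =ᶠ[𝓝[≠] x] f := fun x => 
    (hm.toMeromorphicNFOn_eq_self_on_nhdsNE (Set.mem_univ x)).symm
  have hfa : ∀ x, AnalyticAt ℂ f x := by
    intro x
    have hnf := meromorphicNFOn_toMeromorphicNFOn z Set.univ (Set.mem_univ x)
    rw [← hnf.meromorphicOrderAt_nonneg_iff_analyticAt]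
    rw [← meromorphicOrderAt_congr (hfz x)]
    exact hord x
  have hfp : ∀ w, (∀ x, z (x + w) = z x) → ∀ x, f (x + w) = f x := by
    intro w hw x
    have t1 : Filter.Tendsto (fun y => f (y + w)) (𝓝[≠] x) (𝓝 (f (x + w))) :=
      ((hfa (x + w)).continuousAt.comp_of_eq (f := fun y => y + w)
        (by fun_prop) rfl).tendsto.mono_left nhdsWithin_le_nhds
    have t2 : Filter.Tendsto f (𝓝[≠] x) (𝓝 (f x)) :=
      (hfa x).continuousAt.tendsto.mono_left nhdsWithin_le_nhds
    have hsh : Filter.Tendsto (fun y => y + w) (𝓝[≠] x) (𝓝[≠] (x + w)) := by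
      refine tendsto_nhdsWithin_of_tendsto_nhds_of_eventually_within _ ?_ ?_
      · exact (Continuous.tendsto (by fun_prop) x).mono_left nhdsWithin_le_nhds
      · filter_upwards [self_mem_nhdsWithin] with y hy
        simpa using hy
    refine tendsto_nhds_unique (t1.congr' ?_) t2
    filter_upwards [hsh.eventually (hfz (x + w)), hfz x] with y h1 h2
    rw [← h1, hw, h2]
  obtain ⟨w1, w2, h1, h2, him, hper⟩ := hp
  obtain ⟨c, hc⟩ := entire_periodic f (fun x => (hfa x).differentiableAt)
    ⟨w1, w2, h1, h2, him, fun x =>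
      ⟨hfp w1 (fun x => (hper x).1) x, hfp w2 (fun x => (hper x).2) x⟩⟩
  refine ⟨c, fun x hx => ?_⟩
  have t1 : Filter.Tendsto z (𝓝[≠] x) (𝓝 (z x)) :=
    hx.continuousAt.tendsto.mono_left nhdsWithin_le_nhds
  have t2 : Filter.Tendsto z (𝓝[≠] x) (𝓝 c) := by
    refine tendsto_const_nhds.congr' ?_
    filter_upwards [hfz x] with y hy
    rw [hy, hc]
  exact tendsto_nhds_unique t1 t2
end
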